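/- Fix a real number c, a real number a with a > c_− (where c_− = max(0,−c)), and an integer r ≥ 1. Let A_EC = { f ∈ D : φ_EC(f) ≥ a } with φ_EC(f) = sup_{t∈[0,1]} { f(t) − c t − (r+1)·J_r^t(f) + r·J_{r+1}^t(f) }, let A_EC^ε = { f ∈ D : d(f, A_EC) ≤ ε } for ε > 0, and let D_{≤j} be the set of nondecreasing step functions vanishing at the origin with at most j steps. Then there exists ε > 0 such that A_EC^ε ∩ D_{≤r+1} is bounded away from D_{≤r} in the Skorokhod J1 metric, i.e. inf { d(f,g) : f ∈ A_EC^ε ∩ D_{≤r+1}, g ∈ D_{≤r} } > 0. In particular, this holds for every ε ≤ (a − c_−)/(2(|c| + 4r² + 4r + 1)). -/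

import Mathlib

open MeasureTheory Filter Set Polynomial

noncomputable section

/-- Jump of `f` at `s`, with the convention `f(0⁻) = f(0)` (so the jump at `0` is `0`). -/
def jumpAt (f : ℝ → ℝ) (s : ℝ) : ℝ :=
  if s = 0 then 0 else f s - Function.leftLim f s

/-- `J m t f`: supremum over `m`-tuples of pairwise distinct points of `[0,t]` of the
sum of the jumps of `f` at these points (`J m 0 f = 0`). -/
def J (m : ℕ) (t : ℝ) (f : ℝ → ℝ) : ℝ :=
  ⨆ s : { s : Fin m → ℝ // (∀ i, s i ∈ Set.Icc 0 t) ∧ Function.Injective s },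
    ∑ i, jumpAt f (s.val i)

/-- `f` is càdlàg on `[0,1]`: right-continuous, with left limits. -/
def Cadlag (f : ℝ → ℝ) : Prop :=
  (∀ x ∈ Set.Icc (0:ℝ) 1, ContinuousWithinAt f (Set.Ici x) x) ∧
  (∀ x ∈ Set.Ioc (0:ℝ) 1, ∃ l, Filter.Tendsto f (nhdsWithin x (Set.Iio x)) (nhds l))

/-- A strictly increasing continuous bijection of `[0,1]` onto itself. -/
def TimeChange (l : ℝ → ℝ) : Prop :=
  StrictMonoOn l (Set.Icc 0 1) ∧ ContinuousOn l (Set.Icc 0 1) ∧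
    Set.BijOn l (Set.Icc 0 1) (Set.Icc 0 1)

/-- Uniform (sup) norm on `[0,1]`. -/
def supIcc (f : ℝ → ℝ) : ℝ := ⨆ x : Set.Icc (0:ℝ) 1, |f x.val|

/-- The Skorokhod J1 metric on càdlàg functions on `[0,1]`. -/
def skorokhodDist (f g : ℝ → ℝ) : ℝ :=
  ⨅ l : { l : ℝ → ℝ // TimeChange l },
    max (supIcc fun x => l.val x - x) (supIcc fun x => f x - g (l.val x))

/-- The LCR functional `φ_LCR(f) = sup_{t∈[0,1]} { f(t) − c t − J_r^t(f) }`. -/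
def phiLCR (c : ℝ) (r : ℕ) (f : ℝ → ℝ) : ℝ :=
  ⨆ t : Set.Icc (0:ℝ) 1, (f t.val - c * t.val - J r t.val f)

/-- The ECOMOR functional
`φ_EC(f) = sup_{t∈[0,1]} { f(t) − c t − (r+1)·J_r^t(f) + r·J_{r+1}^t(f) }`. -/
def phiEC (c : ℝ) (r : ℕ) (f : ℝ → ℝ) : ℝ :=
  ⨆ t : Set.Icc (0:ℝ) 1,
    (f t.val - c * t.val - ((r:ℝ) + 1) * J r t.val f + (r:ℝ) * J (r+1) t.val f)

/-- The step function `x ↦ ∑ i, y i · 1_{[τ i, 1]}(x)`, viewed as a function on `ℝ`. -/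
def stepFun {k : ℕ} (y τ : Fin k → ℝ) : ℝ → ℝ :=
  fun x => ∑ i, if τ i ≤ x then y i else 0

/-- Nondecreasing step functions vanishing at the origin with at most `j` steps. -/
def stepSet (j : ℕ) : Set (ℝ → ℝ) :=
  { f | ∃ k : ℕ, k ≤ j ∧ ∃ y τ : Fin k → ℝ,
      (∀ i, 0 < y i) ∧ (∀ i, τ i ∈ Set.Ioo (0:ℝ) 1) ∧ Function.Injective τ ∧
      f = stepFun y τ }

/-- Skorokhod distance from a function to a set of functions. -/
def distToSet (f : ℝ → ℝ) (A : Set (ℝ → ℝ)) : ℝ := ⨅ g : A, skorokhodDist f g.val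

/-- The Gauss hypergeometric function `₂F₁(b,e;d;z)`. -/
def hyp2F1 (b e d z : ℝ) : ℝ :=
  ∑' k : ℕ, ((ascPochhammer ℝ k).eval b * (ascPochhammer ℝ k).eval e /
    (ascPochhammer ℝ k).eval d) * z ^ k / (k.factorial : ℝ)

end

/-- The `ε`-fattening (in Skorokhod distance) of `A_EC = {f ∈ D : φ_EC(f) ≥ a}`,
intersected with the step functions with at most `r+1` steps, is bounded away from the
step functions with at most `r` steps. -/
def BoundedAwayEC (c a ε : ℝ) (r : ℕ) : Prop :=
  0 < sInf { d : ℝ | ∃ f,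
      (Cadlag f ∧ distToSet f { h | Cadlag h ∧ a ≤ phiEC c r h } ≤ ε) ∧
      f ∈ stepSet (r+1) ∧ ∃ g ∈ stepSet r, d = skorokhodDist f g }

open Topology in
/-- A step function jumps by `y i` at `τ i`: its left limit drops the step located at `s`. -/
lemma tendsto_stepFun_left {k : ℕ} (y τ : Fin k → ℝ) (s : ℝ) :
    Tendsto (stepFun y τ) (𝓝[<] s) (𝓝 (∑ i, if τ i < s then y i else 0)) := by
  unfold stepFun
  refine tendsto_finsetSum _ fun i _ => ?_
  by_cases h : τ i < s
  · rw [if_pos h]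
    refine tendsto_const_nhds.congr' ?_
    filter_upwards [mem_nhdsWithin_of_mem_nhds (Ioi_mem_nhds h)] with x hx
    rw [if_pos (le_of_lt hx)]
  · rw [if_neg h]
    refine tendsto_const_nhds.congr' ?_
    filter_upwards [self_mem_nhdsWithin] with x hx
    rw [if_neg]
    exact fun h' => h (lt_of_le_of_lt h' hx)

lemma cadlag_stepFun {k : ℕ} (y τ : Fin k → ℝ) : Cadlag (stepFun y τ) := by
  refine ⟨fun x _ => ?_, fun x _ => ⟨_, tendsto_stepFun_left y τ x⟩⟩
  unfold ContinuousWithinAt stepFun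
  refine tendsto_finsetSum _ fun i _ => ?_
  by_cases h : τ i ≤ x
  · rw [if_pos h]
    refine tendsto_const_nhds.congr' ?_
    filter_upwards [self_mem_nhdsWithin] with z hz
    rw [if_pos (h.trans hz)]
  · rw [if_neg h]
    refine tendsto_const_nhds.congr' ?_
    filter_upwards [mem_nhdsWithin_of_mem_nhds (Iio_mem_nhds (not_le.1 h))] with z hz
    rw [if_neg (not_le.2 hz)]

lemma cadlag_of_mem_stepSet {j : ℕ} {f : ℝ → ℝ} (hf : f ∈ stepSet j) : Cadlag f := by
  obtain ⟨k, -, y, τ, -, -, -, rfl⟩ := hf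
  exact cadlag_stepFun y τ

lemma jumpAt_stepFun {k : ℕ} (y τ : Fin k → ℝ) (hτ : ∀ i, 0 < τ i) (s : ℝ) :
    jumpAt (stepFun y τ) s = ∑ i, if τ i = s then y i else 0 := by
  unfold jumpAt
  by_cases hs : s = 0
  · rw [if_pos hs]
    refine (Finset.sum_eq_zero fun i _ => if_neg ?_).symm
    rw [hs]
    exact (hτ i).ne'
  · rw [if_neg hs, leftLim_eq_of_tendsto (tendsto_stepFun_left y τ s), stepFun,
      ← Finset.sum_sub_distrib]
    refine Finset.sum_congr rfl fun i _ => ?_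
    rcases lt_trichotomy (τ i) s with h | h | h
    · simp [h, h.le, h.ne]
    · simp [h]
    · simp [h.not_ge, h.not_gt, h.ne']

lemma jumpAt_stepFun_nonneg {k : ℕ} {y τ : Fin k → ℝ} (hy : ∀ i, 0 < y i) (hτ : ∀ i, 0 < τ i)
    (s : ℝ) : 0 ≤ jumpAt (stepFun y τ) s := by
  rw [jumpAt_stepFun y τ hτ]
  refine Finset.sum_nonneg fun i _ => ?_
  split_ifs
  exacts [(hy i).le, le_rfl]

lemma jumpAt_stepFun_apply {k : ℕ} {y τ : Fin k → ℝ} (hτ : ∀ i, 0 < τ i)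
    (hinj : Function.Injective τ) (i : Fin k) : jumpAt (stepFun y τ) (τ i) = y i := by
  rw [jumpAt_stepFun y τ hτ, Finset.sum_eq_single i]
  · simp
  · intro j _ hj
    rw [if_neg (fun h => hj (hinj h))]
  · simp

lemma jumpAt_stepFun_of_notMem {k : ℕ} {y τ : Fin k → ℝ} (hτ : ∀ i, 0 < τ i) {s : ℝ}
    (hs : ∀ i, τ i ≠ s) : jumpAt (stepFun y τ) s = 0 := by
  rw [jumpAt_stepFun y τ hτ]
  exact Finset.sum_eq_zero fun i _ => if_neg (hs i)

lemma sum_jumpAt_stepFun_le {k m : ℕ} {y τ : Fin k → ℝ} (hy : ∀ i, 0 < y i)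
    (hτ : ∀ i, 0 < τ i) {t : ℝ} {s : Fin m → ℝ} (hs : ∀ j, s j ∈ Icc 0 t)
    (hinj : Function.Injective s) :
    ∑ j, jumpAt (stepFun y τ) (s j) ≤ stepFun y τ t := by
  simp_rw [jumpAt_stepFun y τ hτ]
  rw [Finset.sum_comm]
  refine Finset.sum_le_sum fun i _ => ?_
  by_cases h : ∃ j, τ i = s j
  · obtain ⟨j, hj⟩ := h
    rw [Finset.sum_eq_single j, if_pos hj, if_pos (hj ▸ (hs j).2)]
    · intro j' _ hne
      exact if_neg fun h' => hne (hinj (h'.symm.trans hj))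
    · simp
  · push Not at h
    rw [Finset.sum_eq_zero fun j _ => if_neg (h j)]
    split_ifs
    exacts [(hy i).le, le_rfl]

lemma stepFun_nonneg {k : ℕ} {y τ : Fin k → ℝ} (hy : ∀ i, 0 < y i) (t : ℝ) :
    0 ≤ stepFun y τ t := by
  refine Finset.sum_nonneg fun i _ => ?_
  split_ifs
  exacts [(hy i).le, le_rfl]

lemma J_stepFun_le {k : ℕ} {y τ : Fin k → ℝ} (hy : ∀ i, 0 < y i) (hτ : ∀ i, 0 < τ i)
    (m : ℕ) (t : ℝ) : J m t (stepFun y τ) ≤ stepFun y τ t :=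
  Real.iSup_le (fun s => sum_jumpAt_stepFun_le hy hτ s.2.1 s.2.2) (stepFun_nonneg hy t)

lemma J_stepFun_nonneg {k : ℕ} {y τ : Fin k → ℝ} (hy : ∀ i, 0 < y i) (hτ : ∀ i, 0 < τ i)
    (m : ℕ) (t : ℝ) : 0 ≤ J m t (stepFun y τ) :=
  Real.iSup_nonneg fun _ => Finset.sum_nonneg fun _ _ => jumpAt_stepFun_nonneg hy hτ _

lemma sum_jumpAt_stepFun_le_J {k : ℕ} {y τ : Fin k → ℝ} (hy : ∀ i, 0 < y i)
    (hτ : ∀ i, 0 < τ i) {m : ℕ} {t : ℝ} (ht : 0 < t) {F : Finset ℝ}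
    (hF : ∀ x ∈ F, x ∈ Icc 0 t) (hcard : F.card ≤ m) :
    ∑ x ∈ F, jumpAt (stepFun y τ) x ≤ J m t (stepFun y τ) := by
  obtain ⟨G, hG, hGc⟩ := ((Icc_infinite ht).sdiff F.finite_toSet).exists_subset_card_eq
    (m - F.card)
  have hdisj : Disjoint F G := by
    rw [Finset.disjoint_left]
    exact fun x hx hxG => (hG hxG).2 hx
  have hc : (F ∪ G).card = m := by
    rw [Finset.card_union_of_disjoint hdisj, hGc]
    omega
  let e := ((F ∪ G).equivFinOfCardEq hc).symm
  have hmem : ∀ x ∈ F ∪ G, x ∈ Icc 0 t := by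
    intro x hx
    rcases Finset.mem_union.1 hx with h | h
    exacts [hF x h, (hG h).1]
  have hbdd : BddAbove (range fun s : { s : Fin m → ℝ //
      (∀ i, s i ∈ Icc 0 t) ∧ Function.Injective s } => ∑ i, jumpAt (stepFun y τ) (s.val i)) := by
    refine ⟨stepFun y τ t, ?_⟩
    rintro _ ⟨s, rfl⟩
    exact sum_jumpAt_stepFun_le hy hτ s.2.1 s.2.2
  calc ∑ x ∈ F, jumpAt (stepFun y τ) x
      ≤ ∑ x ∈ F ∪ G, jumpAt (stepFun y τ) x :=
        Finset.sum_le_sum_of_subset_of_nonneg Finset.subset_union_left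
          fun x _ _ => jumpAt_stepFun_nonneg hy hτ x
    _ = ∑ i, jumpAt (stepFun y τ) (e i) := by
        rw [e.sum_comp fun x : { x // x ∈ F ∪ G } => jumpAt (stepFun y τ) x,
          Finset.sum_coe_sort (F ∪ G) (jumpAt (stepFun y τ))]
    _ ≤ J m t (stepFun y τ) :=
        le_ciSup hbdd ⟨fun i => (e i : ℝ), fun i => hmem _ (e i).2,
          Subtype.val_injective.comp e.injective⟩

lemma sum_steps_le_J {k : ℕ} {y τ : Fin k → ℝ} (hy : ∀ i, 0 < y i) (hτ : ∀ i, 0 < τ i)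
    (hinj : Function.Injective τ) {m : ℕ} {t : ℝ} (ht : 0 ≤ t) {I : Finset (Fin k)}
    (hI : I.card ≤ m) :
    ∑ i ∈ I, (if τ i ≤ t then y i else 0) ≤ J m t (stepFun y τ) := by
  rcases ht.eq_or_lt with rfl | ht
  · rw [Finset.sum_eq_zero fun i _ => if_neg (hτ i).not_ge]
    exact J_stepFun_nonneg hy hτ m 0
  · have hmem : ∀ x ∈ (I.filter fun i => τ i ≤ t).image τ, x ∈ Icc 0 t := by
      intro x hx
      obtain ⟨i, hi, rfl⟩ := Finset.mem_image.1 hx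
      exact ⟨(hτ i).le, (Finset.mem_filter.1 hi).2⟩
    refine le_trans (le_of_eq ?_) (sum_jumpAt_stepFun_le_J hy hτ ht hmem
      (Finset.card_image_le.trans ((Finset.card_filter_le _ _).trans hI)))
    rw [Finset.sum_image hinj.injOn, Finset.sum_filter]
    exact Finset.sum_congr rfl fun i _ => by rw [jumpAt_stepFun_apply hτ hinj]

open Topology in
lemma Cadlag.exists_bound {f : ℝ → ℝ} (hf : Cadlag f) :
    ∃ C, ∀ x ∈ Icc (0 : ℝ) 1, |f x| ≤ C := by
  refine isCompact_Icc.induction_on (p := fun s => ∃ C, ∀ x ∈ s, |f x| ≤ C) ⟨0, by simp⟩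
    (fun s t hst ⟨C, hC⟩ => ⟨C, fun x hx => hC x (hst hx)⟩) ?_ ?_
  · rintro s t ⟨C, hC⟩ ⟨C', hC'⟩
    refine ⟨max C C', ?_⟩
    rintro x (hx | hx)
    exacts [(hC x hx).trans (le_max_left _ _), (hC' x hx).trans (le_max_right _ _)]
  · intro x hx
    have hr : ∀ᶠ z in 𝓝[≥] x, |f z| ≤ |f x| + 1 :=
      ((hf.1 x hx).abs.eventually_lt_const (lt_add_one _)).mono fun z hz => hz.le
    rcases hx.1.eq_or_lt with h0 | h0
    · refine ⟨{z | |f z| ≤ |f x| + 1}, ?_, _, fun z hz => hz⟩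
      exact nhdsWithin_mono x (fun z hz => h0 ▸ hz.1) hr
    · obtain ⟨l, hl⟩ := hf.2 x ⟨h0, hx.2⟩
      have hl' : ∀ᶠ z in 𝓝[<] x, |f z| ≤ |l| + 1 :=
        (hl.abs.eventually_lt_const (lt_add_one _)).mono fun z hz => hz.le
      refine ⟨{z | |f z| ≤ max (|f x| + 1) (|l| + 1)}, ?_, _, fun z hz => hz⟩
      refine mem_nhdsWithin_of_mem_nhds ?_
      rw [← nhdsLT_sup_nhdsGE x]
      exact ⟨hl'.mono fun z hz => hz.trans (le_max_right _ _),
        hr.mono fun z hz => hz.trans (le_max_left _ _)⟩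

lemma supIcc_nonneg (f : ℝ → ℝ) : 0 ≤ supIcc f :=
  Real.iSup_nonneg fun _ => abs_nonneg _

lemma le_supIcc {f : ℝ → ℝ} {C : ℝ} (hf : ∀ x ∈ Icc (0 : ℝ) 1, |f x| ≤ C) {x : ℝ}
    (hx : x ∈ Icc (0 : ℝ) 1) : |f x| ≤ supIcc f := by
  refine le_ciSup (f := fun x : Icc (0 : ℝ) 1 => |f x.val|) ⟨C, ?_⟩ ⟨x, hx⟩
  rintro _ ⟨z, rfl⟩
  exact hf z z.2

lemma TimeChange.mem {l : ℝ → ℝ} (hl : TimeChange l) {x : ℝ} (hx : x ∈ Icc (0 : ℝ) 1) :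
    l x ∈ Icc (0 : ℝ) 1 := hl.2.2.mapsTo hx

lemma TimeChange.map_zero {l : ℝ → ℝ} (hl : TimeChange l) : l 0 = 0 := by
  have h0 : (0 : ℝ) ∈ Icc (0 : ℝ) 1 := by simp
  obtain ⟨x, hx, hx0⟩ := hl.2.2.surjOn h0
  exact le_antisymm (hx0 ▸ hl.1.monotoneOn h0 hx hx.1) (hl.mem h0).1

lemma timeChange_id : TimeChange id :=
  ⟨strictMonoOn_id, continuousOn_id, bijOn_id _⟩

instance : Nonempty { l : ℝ → ℝ // TimeChange l } := ⟨⟨id, timeChange_id⟩⟩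

lemma TimeChange.abs_sub_le_supIcc {l : ℝ → ℝ} (hl : TimeChange l) {x : ℝ}
    (hx : x ∈ Icc (0 : ℝ) 1) : |l x - x| ≤ supIcc fun x => l x - x := by
  refine le_supIcc (f := fun x => l x - x) (C := 1) (fun z hz => ?_) hx
  have := hl.mem hz
  rw [abs_le]
  constructor <;> linarith [hz.1, hz.2, this.1, this.2]

lemma TimeChange.abs_comp_sub_le_supIcc {f g l : ℝ → ℝ} (hl : TimeChange l) (hf : Cadlag f)
    (hg : Cadlag g) {x : ℝ} (hx : x ∈ Icc (0 : ℝ) 1) :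
    |f x - g (l x)| ≤ supIcc fun x => f x - g (l x) := by
  obtain ⟨C, hC⟩ := hf.exists_bound
  obtain ⟨C', hC'⟩ := hg.exists_bound
  exact le_supIcc (f := fun x => f x - g (l x)) (C := C + C')
    (fun z hz => (abs_sub _ _).trans (add_le_add (hC z hz) (hC' _ (hl.mem hz)))) hx

open Topology in
lemma TimeChange.tendsto_nhdsLT {l : ℝ → ℝ} (hl : TimeChange l) {s : ℝ}
    (hs : s ∈ Ioc (0 : ℝ) 1) : Tendsto l (𝓝[<] s) (𝓝[<] (l s)) := by
  have hs' : s ∈ Icc (0 : ℝ) 1 := ⟨hs.1.le, hs.2⟩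
  have hev : ∀ᶠ x in 𝓝[<] s, x ∈ Ico 0 s :=
    mem_of_superset (Ioo_mem_nhdsLT hs.1) Ioo_subset_Ico_self
  refine tendsto_nhdsWithin_iff.2 ⟨?_, ?_⟩
  · refine (hl.2.1 s hs').mono_left (nhdsWithin_le_iff.2 ?_)
    filter_upwards [hev] with x hx
    exact ⟨hx.1, hx.2.le.trans hs.2⟩
  · filter_upwards [hev] with x hx
    exact hl.1 ⟨hx.1, hx.2.le.trans hs.2⟩ hs' hx.2

/-- Uniformly close functions have close jumps. -/
lemma TimeChange.abs_jumpAt_sub_le {f g l : ℝ → ℝ} (hl : TimeChange l) (hf : Cadlag f)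
    (hg : Cadlag g) {δ : ℝ} (hδ : ∀ x ∈ Icc (0 : ℝ) 1, |f x - g (l x)| ≤ δ) {s : ℝ}
    (hs : s ∈ Icc (0 : ℝ) 1) : |jumpAt f s - jumpAt g (l s)| ≤ 2 * δ := by
  have hδ0 : 0 ≤ δ := (abs_nonneg _).trans (hδ s hs)
  rcases hs.1.eq_or_lt with rfl | h0
  · simp [jumpAt, hl.map_zero, hδ0]
  have hs' : s ∈ Ioc (0 : ℝ) 1 := ⟨h0, hs.2⟩
  have hl0 : 0 < l s := by
    have := hl.1 (by simp) hs h0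
    rwa [hl.map_zero] at this
  obtain ⟨L, hL⟩ := hf.2 s hs'
  obtain ⟨M, hM⟩ := hg.2 (l s) ⟨hl0, (hl.mem hs).2⟩
  have hlim : |L - M| ≤ δ := by
    refine le_of_tendsto (hL.sub (hM.comp (hl.tendsto_nhdsLT hs'))).abs ?_
    filter_upwards [Ioo_mem_nhdsLT h0] with x hx
    exact hδ x ⟨hx.1.le, hx.2.le.trans hs.2⟩
  rw [jumpAt, jumpAt, if_neg h0.ne', if_neg hl0.ne', leftLim_eq_of_tendsto hL,
    leftLim_eq_of_tendsto hM]
  have h1 := abs_le.1 (hδ s hs)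
  have h2 := abs_le.1 hlim
  rw [abs_le]
  constructor <;> linarith [h1.1, h1.2, h2.1, h2.2]

lemma Cadlag.bddAbove_sum_jumpAt {f : ℝ → ℝ} (hf : Cadlag f) (m : ℕ) {t : ℝ} (ht : t ≤ 1) :
    BddAbove (range fun s : { s : Fin m → ℝ //
      (∀ i, s i ∈ Icc 0 t) ∧ Function.Injective s } => ∑ i, jumpAt f (s.val i)) := by
  obtain ⟨C, hC⟩ := hf.exists_bound
  refine ⟨∑ _i : Fin m, 2 * C, ?_⟩
  rintro _ ⟨s, rfl⟩
  refine Finset.sum_le_sum fun i _ => ?_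
  have hs : s.1 i ∈ Icc (0 : ℝ) 1 := ⟨(s.2.1 i).1, (s.2.1 i).2.trans ht⟩
  have hz : jumpAt (fun _ => (0 : ℝ)) (id (s.1 i)) = 0 := by
    rw [jumpAt, leftLim_eq_of_tendsto tendsto_const_nhds]
    simp
  have hc : Cadlag fun _ => (0 : ℝ) :=
    ⟨fun _ _ => continuousWithinAt_const, fun _ _ => ⟨0, tendsto_const_nhds⟩⟩
  have := timeChange_id.abs_jumpAt_sub_le hf hc (δ := C) (by simpa using hC) hs
  rw [hz, sub_zero] at this
  exact (le_abs_self _).trans this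

/-- The functional `J` is Lipschitz along time changes, in one direction. -/
lemma TimeChange.J_comp_le {f g l : ℝ → ℝ} (hl : TimeChange l) (hf : Cadlag f)
    (hg : Cadlag g) {δ : ℝ} (hδ : ∀ x ∈ Icc (0 : ℝ) 1, |f x - g (l x)| ≤ δ) {m : ℕ} {t : ℝ}
    (ht : t ∈ Icc (0 : ℝ) 1) : J m (l t) g ≤ J m t f + 2 * m * δ := by
  have hδ0 : 0 ≤ δ := (abs_nonneg _).trans (hδ t ht)
  by_cases hne : Nonempty { s : Fin m → ℝ // (∀ i, s i ∈ Icc 0 (l t)) ∧ Function.Injective s }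
  · refine ciSup_le fun s => ?_
    have hpre : ∀ i, ∃ x ∈ Icc (0 : ℝ) 1, l x = s.1 i := fun i =>
      hl.2.2.surjOn ⟨(s.2.1 i).1, (s.2.1 i).2.trans (hl.mem ht).2⟩
    choose x hx hxs using hpre
    have hxt : ∀ i, x i ∈ Icc 0 t := fun i =>
      ⟨(hx i).1, (hl.1.le_iff_le (hx i) ht).1 (by rw [hxs]; exact (s.2.1 i).2)⟩
    have hxinj : Function.Injective x := fun i j hij =>
      s.2.2 (by rw [← hxs, ← hxs, hij])
    calc ∑ i, jumpAt g (s.1 i) ≤ ∑ i, (jumpAt f (x i) + 2 * δ) := by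
          refine Finset.sum_le_sum fun i _ => ?_
          have := abs_le.1 (hl.abs_jumpAt_sub_le hf hg hδ (hx i))
          rw [hxs] at this
          linarith [this.1]
      _ = ∑ i, jumpAt f (x i) + 2 * m * δ := by
          rw [Finset.sum_add_distrib]
          simp
          ring
      _ ≤ J m t f + 2 * m * δ := by
          gcongr
          exact le_ciSup (hf.bddAbove_sum_jumpAt m ht.2) ⟨x, hxt, hxinj⟩
  · have hne' : ¬ Nonempty { s : Fin m → ℝ // (∀ i, s i ∈ Icc 0 t) ∧ Function.Injective s } := by
      rintro ⟨s, hs, hsi⟩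
      have h1 : ∀ i, s i ∈ Icc (0 : ℝ) 1 := fun i => ⟨(hs i).1, (hs i).2.trans ht.2⟩
      exact hne ⟨⟨fun i => l (s i), fun i => ⟨(hl.mem (h1 i)).1,
        hl.1.monotoneOn (h1 i) ht (hs i).2⟩, fun i j hij => hsi (hl.2.2.injOn (h1 i) (h1 j) hij)⟩⟩
    rw [not_nonempty_iff] at hne hne'
    rw [J, J, Real.iSup_of_isEmpty, Real.iSup_of_isEmpty]
    positivity

/-- The functional `J` is Lipschitz along time changes, in the other direction. -/
lemma TimeChange.J_le_comp {f g l : ℝ → ℝ} (hl : TimeChange l) (hf : Cadlag f)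
    (hg : Cadlag g) {δ : ℝ} (hδ : ∀ x ∈ Icc (0 : ℝ) 1, |f x - g (l x)| ≤ δ) {m : ℕ} {t : ℝ}
    (ht : t ∈ Icc (0 : ℝ) 1) : J m t f ≤ J m (l t) g + 2 * m * δ := by
  have hδ0 : 0 ≤ δ := (abs_nonneg _).trans (hδ t ht)
  by_cases hne : Nonempty { s : Fin m → ℝ // (∀ i, s i ∈ Icc 0 t) ∧ Function.Injective s }
  · refine ciSup_le fun s => ?_
    have h1 : ∀ i, s.1 i ∈ Icc (0 : ℝ) 1 := fun i => ⟨(s.2.1 i).1, (s.2.1 i).2.trans ht.2⟩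
    calc ∑ i, jumpAt f (s.1 i) ≤ ∑ i, (jumpAt g (l (s.1 i)) + 2 * δ) := by
          refine Finset.sum_le_sum fun i _ => ?_
          have := abs_le.1 (hl.abs_jumpAt_sub_le hf hg hδ (h1 i))
          linarith [this.2]
      _ = ∑ i, jumpAt g (l (s.1 i)) + 2 * m * δ := by
          rw [Finset.sum_add_distrib]
          simp
          ring
      _ ≤ J m (l t) g + 2 * m * δ := by
          gcongr
          exact le_ciSup (hg.bddAbove_sum_jumpAt m (hl.mem ht).2) ⟨fun i => l (s.1 i),
            fun i => ⟨(hl.mem (h1 i)).1, hl.1.monotoneOn (h1 i) ht (s.2.1 i).2⟩,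
            fun i j hij => s.2.2 (hl.2.2.injOn (h1 i) (h1 j) hij)⟩
  · have hne' : ¬ Nonempty { s : Fin m → ℝ //
        (∀ i, s i ∈ Icc 0 (l t)) ∧ Function.Injective s } := by
      rintro ⟨s, hs, hsi⟩
      have hpre : ∀ i, ∃ x ∈ Icc (0 : ℝ) 1, l x = s i := fun i =>
        hl.2.2.surjOn ⟨(hs i).1, (hs i).2.trans (hl.mem ht).2⟩
      choose x hx hxs using hpre
      exact hne ⟨⟨x, fun i => ⟨(hx i).1, (hl.1.le_iff_le (hx i) ht).1
        (by rw [hxs]; exact (hs i).2)⟩, fun i j hij => hsi (by rw [← hxs, ← hxs, hij])⟩⟩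
    rw [not_nonempty_iff] at hne hne'
    rw [J, J, Real.iSup_of_isEmpty, Real.iSup_of_isEmpty]
    positivity

lemma skorokhodDist_nonneg (f g : ℝ → ℝ) : 0 ≤ skorokhodDist f g :=
  Real.iInf_nonneg fun _ => le_max_of_le_left (supIcc_nonneg _)

lemma skorokhodDist_self_le (f : ℝ → ℝ) : skorokhodDist f f ≤ 0 := by
  refine (ciInf_le ⟨0, ?_⟩ (⟨id, timeChange_id⟩ : { l : ℝ → ℝ // TimeChange l })).trans ?_
  · rintro _ ⟨l, rfl⟩
    exact le_max_of_le_left (supIcc_nonneg _)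
  · simp [supIcc]

lemma distToSet_nonpos {f : ℝ → ℝ} {A : Set (ℝ → ℝ)} (hf : f ∈ A) : distToSet f A ≤ 0 := by
  refine (ciInf_le ⟨0, ?_⟩ (⟨f, hf⟩ : A)).trans (skorokhodDist_self_le f)
  rintro _ ⟨g, rfl⟩
  exact skorokhodDist_nonneg _ _

/-- A step function with more than `r` steps, all of height at least `η`, is at distance at
least `η / 2` from the step functions with at most `r` steps. -/
lemma le_skorokhodDist_stepSet {k r : ℕ} (hk : r < k) {y τ : Fin k → ℝ}
    (hτ : ∀ i, τ i ∈ Ioo (0 : ℝ) 1) (hinj : Function.Injective τ) {η : ℝ}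
    (hη : ∀ i, η ≤ y i) {g : ℝ → ℝ} (hg : g ∈ stepSet r) :
    η / 2 ≤ skorokhodDist (stepFun y τ) g := by
  obtain ⟨k', hk', z, σ, -, hσ, -, rfl⟩ := hg
  refine le_ciInf fun ⟨l, hl⟩ => le_max_of_le_right ?_
  have hmem : ∀ i, τ i ∈ Icc (0 : ℝ) 1 := fun i => Ioo_subset_Icc_self (hτ i)
  obtain ⟨i, hi⟩ : ∃ i, ∀ j, σ j ≠ l (τ i) := by
    by_contra! h
    choose p hp using h
    have hpinj : Function.Injective p := fun i j hij =>
      hinj (hl.2.2.injOn (hmem i) (hmem j) (by rw [← hp, ← hp, hij]))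
    have := Fintype.card_le_of_injective p hpinj
    simp only [Fintype.card_fin] at this
    omega
  have := hl.abs_jumpAt_sub_le (cadlag_stepFun y τ) (cadlag_stepFun z σ)
    (fun x hx => hl.abs_comp_sub_le_supIcc (cadlag_stepFun y τ) (cadlag_stepFun z σ) hx)
    (hmem i)
  rw [jumpAt_stepFun_apply (fun i => (hτ i).1) hinj,
    jumpAt_stepFun_of_notMem (fun i => (hσ i).1) hi, sub_zero] at this
  linarith [le_abs_self (y i), hη i]

/-- The objective maximised in `phiEC`. -/
noncomputable def objEC (c : ℝ) (r : ℕ) (f : ℝ → ℝ) (t : ℝ) : ℝ :=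
  f t - c * t - ((r : ℝ) + 1) * J r t f + (r : ℝ) * J (r + 1) t f

lemma objEC_stepFun_le {k : ℕ} {y τ : Fin k → ℝ} (hy : ∀ i, 0 < y i) (hτ : ∀ i, 0 < τ i)
    (c : ℝ) (r : ℕ) (t : ℝ) :
    objEC c r (stepFun y τ) t
      ≤ ((r : ℝ) + 1) * (stepFun y τ t - J r t (stepFun y τ)) - c * t := by
  have := mul_le_mul_of_nonneg_left (J_stepFun_le hy hτ (r + 1) t) (Nat.cast_nonneg (α := ℝ) r)
  unfold objEC
  linarith

lemma TimeChange.objEC_comp_le {f g l : ℝ → ℝ} (hl : TimeChange l) (hf : Cadlag f)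
    (hg : Cadlag g) {δ : ℝ} (hlδ : ∀ x ∈ Icc (0 : ℝ) 1, |l x - x| ≤ δ)
    (hδ : ∀ x ∈ Icc (0 : ℝ) 1, |f x - g (l x)| ≤ δ) (c : ℝ) (r : ℕ) {t : ℝ}
    (ht : t ∈ Icc (0 : ℝ) 1) :
    objEC c r g (l t) ≤
      objEC c r f t + (|c| + 4 * (r : ℝ) ^ 2 + 4 * (r : ℝ) + 1) * δ := by
  have hr : (0 : ℝ) ≤ r := Nat.cast_nonneg r
  have h1 := (abs_le.1 (hδ t ht)).1
  have h2 := mul_le_mul_of_nonneg_left (hl.J_le_comp hf hg hδ (m := r) ht)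
    (by linarith : (0 : ℝ) ≤ r + 1)
  have h3 := mul_le_mul_of_nonneg_left (hl.J_comp_le hf hg hδ (m := r + 1) ht) hr
  have h4 : -(c * (l t - t)) ≤ |c| * δ := by
    calc -(c * (l t - t)) ≤ |c * (l t - t)| := neg_le_abs _
      _ = |c| * |l t - t| := abs_mul _ _
      _ ≤ |c| * δ := mul_le_mul_of_nonneg_left (hlδ t ht) (abs_nonneg c)
  push_cast at h3
  unfold objEC
  nlinarith

/-- If the objective of a step function with at most `r + 1` steps exceeds
`max 0 (-c) + (r + 1) * η`, there are exactly `r + 1` steps, each of height at least `η`. -/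
lemma steps_large_of_le_objEC {k r : ℕ} (hk : k ≤ r + 1) {y τ : Fin k → ℝ} (hy : ∀ i, 0 < y i)
    (hτ : ∀ i, 0 < τ i) (hinj : Function.Injective τ) {c η t : ℝ} (hη : 0 < η)
    (ht : t ∈ Icc (0 : ℝ) 1)
    (h : max 0 (-c) + ((r : ℝ) + 1) * η ≤ objEC c r (stepFun y τ) t) :
    r < k ∧ ∀ i, η ≤ y i := by
  have hr : (0 : ℝ) < r + 1 := by positivity
  have hc : -(c * t) ≤ max 0 (-c) := by
    rcases le_total 0 c with h0 | h0
    · exact (neg_nonpos.2 (mul_nonneg h0 ht.1)).trans (le_max_left _ _)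
    · refine le_trans ?_ (le_max_right _ _)
      nlinarith [ht.2]
  have hdiff : η ≤ stepFun y τ t - J r t (stepFun y τ) := by
    have := objEC_stepFun_le hy hτ c r t
    exact le_of_mul_le_mul_left (by linarith) hr
  constructor
  · by_contra! hkr
    have := sum_steps_le_J hy hτ hinj ht.1 (m := r) (I := Finset.univ) (by simpa using hkr)
    unfold stepFun at *
    linarith
  · intro i
    have := sum_steps_le_J hy hτ hinj ht.1 (m := r) (I := Finset.univ.erase i)
      (by rw [Finset.card_erase_of_mem (Finset.mem_univ i)]; simp; omega)
    have hsum := Finset.add_sum_erase Finset.univ (fun i => if τ i ≤ t then y i else 0)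
      (Finset.mem_univ i)
    have hle : (if τ i ≤ t then y i else 0) ≤ y i := by
      split_ifs
      exacts [le_rfl, (hy i).le]
    unfold stepFun at *
    linarith

lemma stepFun_le_sum {k : ℕ} {y τ : Fin k → ℝ} (hy : ∀ i, 0 < y i) (t : ℝ) :
    stepFun y τ t ≤ ∑ i, y i := by
  refine Finset.sum_le_sum fun i _ => ?_
  split_ifs
  exacts [le_rfl, (hy i).le]

lemma exists_mem_stepSet_le_phiEC (c a : ℝ) (r : ℕ) :
    ∃ f ∈ stepSet (r + 1), a ≤ phiEC c r f := by
  set b : ℝ := |a| + |c| + 1 with hb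
  have hb0 : 0 < b := by positivity
  have hr : (0 : ℝ) ≤ r := Nat.cast_nonneg r
  let y : Fin (r + 1) → ℝ := fun _ => b
  let τ : Fin (r + 1) → ℝ := fun i => ((i : ℝ) + 1) / (r + 2)
  have hy : ∀ i, 0 < y i := fun _ => hb0
  have hτ : ∀ i, τ i ∈ Ioo (0 : ℝ) 1 := by
    intro i
    have : (i : ℝ) + 1 ≤ r + 1 := by exact_mod_cast i.2
    refine ⟨by positivity, (div_lt_one (by positivity)).2 (by linarith)⟩
  have hτ0 : ∀ i, 0 < τ i := fun i => (hτ i).1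
  have hinj : Function.Injective τ := by
    intro i j hij
    have h2 : (r : ℝ) + 2 ≠ 0 := by positivity
    have : (i : ℝ) = j := by
      have := (div_left_inj' h2).1 hij
      linarith
    exact Fin.ext (by exact_mod_cast this)
  refine ⟨stepFun y τ, ⟨r + 1, le_rfl, y, τ, hy, hτ, hinj, rfl⟩, ?_⟩
  have hbdd : BddAbove (range fun t : Icc (0 : ℝ) 1 => objEC c r (stepFun y τ) t) := by
    refine ⟨((r : ℝ) + 1) * ∑ i, y i + |c|, ?_⟩
    rintro _ ⟨t, rfl⟩
    refine (objEC_stepFun_le hy hτ0 c r t).trans ?_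
    have h1 : stepFun y τ t - J r t (stepFun y τ) ≤ ∑ i, y i := by
      linarith [stepFun_le_sum (τ := τ) hy t, J_stepFun_nonneg hy hτ0 r t]
    have h2 : -(c * t) ≤ |c| := by
      refine (neg_le_abs _).trans ?_
      rw [abs_mul, abs_of_nonneg t.2.1]
      exact mul_le_of_le_one_right (abs_nonneg c) t.2.2
    have := mul_le_mul_of_nonneg_left h1 (by linarith : (0 : ℝ) ≤ r + 1)
    linarith
  refine le_trans ?_ (le_ciSup hbdd ⟨1, by simp⟩)
  have hval : stepFun y τ 1 = (r + 1) * b := by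
    simp only [stepFun, fun i => (hτ i).2.le, if_true, y]
    simp
  have hJ1 : ((r : ℝ) + 1) * b ≤ J (r + 1) 1 (stepFun y τ) := by
    have := sum_steps_le_J hy hτ0 hinj zero_le_one (m := r + 1) (I := Finset.univ) (by simp)
    rw [← hval]
    exact this
  have hJ : J r 1 (stepFun y τ) ≤ r * b := by
    refine Real.iSup_le (fun s => ?_) (by positivity)
    have : ∀ x, jumpAt (stepFun y τ) x ≤ b := by
      intro x
      by_cases hx : ∃ i, τ i = x
      · obtain ⟨i, rfl⟩ := hx
        rw [jumpAt_stepFun_apply hτ0 hinj]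
      · push Not at hx
        rw [jumpAt_stepFun_of_notMem hτ0 hx]
        exact hb0.le
    refine (Finset.sum_le_sum fun i _ => this (s.1 i)).trans ?_
    simp
  have h1 := mul_le_mul_of_nonneg_left hJ (by linarith : (0 : ℝ) ≤ r + 1)
  have h2 := mul_le_mul_of_nonneg_left hJ1 hr
  have h3 := mul_nonneg hr hb0.le
  simp only [objEC, hval]
  linarith [le_abs_self a, le_abs_self c]

lemma boundedAwayEC_of_le {c a ε : ℝ} {r : ℕ} (ha : max 0 (-c) < a) (hε : 0 < ε)
    (hle : ε ≤ (a - max 0 (-c)) / (2 * (|c| + 4 * (r : ℝ) ^ 2 + 4 * (r : ℝ) + 1))) :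
    BoundedAwayEC c a ε r := by
  set D : ℝ := a - max 0 (-c) with hD
  have hD0 : 0 < D := by linarith
  set K : ℝ := |c| + 4 * (r : ℝ) ^ 2 + 4 * (r : ℝ) + 1 with hK
  have hK0 : 0 < K := by positivity
  have hKε : K * ε ≤ D / 2 := by
    rw [le_div_iff₀ (by positivity)] at hle
    linarith
  set η : ℝ := D / (8 * ((r : ℝ) + 1)) with hη
  have hη0 : 0 < η := by positivity
  have hrη : ((r : ℝ) + 1) * η = D / 8 := by
    rw [hη]
    field_simp
  obtain ⟨f₀, hf₀, hf₀a⟩ := exists_mem_stepSet_le_phiEC c a r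
  have hf₀A : f₀ ∈ { h | Cadlag h ∧ a ≤ phiEC c r h } := ⟨cadlag_of_mem_stepSet hf₀, hf₀a⟩
  refine lt_of_lt_of_le (half_pos hη0) (le_csInf ?_ ?_)
  · exact ⟨_, f₀, ⟨cadlag_of_mem_stepSet hf₀, (distToSet_nonpos hf₀A).trans hε.le⟩, hf₀,
      fun x => 0, ⟨0, Nat.zero_le r, Fin.elim0, Fin.elim0, fun i => i.elim0, fun i => i.elim0,
        fun i => i.elim0, by ext; simp [stepFun]⟩, rfl⟩
  · rintro d ⟨f, ⟨hfc, hfd⟩, ⟨k, hk, y, τ, hy, hτ, hinj, rfl⟩, g, hg, rfl⟩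
    have : Nonempty { h | Cadlag h ∧ a ≤ phiEC c r h } := ⟨⟨f₀, hf₀A⟩⟩
    obtain ⟨⟨h, hhc, hha⟩, hh⟩ := exists_lt_of_ciInf_lt
      (lt_of_le_of_lt hfd (by linarith : ε < 3 / 2 * ε))
    obtain ⟨⟨l, hl⟩, hlt⟩ := exists_lt_of_ciInf_lt hh
    obtain ⟨hl1, hl2⟩ := max_lt_iff.1 hlt
    obtain ⟨⟨t', ht'⟩, hobj⟩ := exists_lt_of_lt_ciSup
      (lt_of_lt_of_le (by linarith : a - D / 8 < a) hha)
    obtain ⟨t, ht, rfl⟩ := hl.2.2.surjOn ht'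
    have hlip := hl.objEC_comp_le hfc hhc
      (fun x hx => (hl.abs_sub_le_supIcc hx).trans hl1.le)
      (fun x hx => (hl.abs_comp_sub_le_supIcc hfc hhc hx).trans hl2.le) c r ht
    change a - D / 8 < objEC c r h (l t) at hobj
    rw [← hK] at hlip
    obtain ⟨hrk, hlarge⟩ := steps_large_of_le_objEC hk hy (fun i => (hτ i).1) hinj hη0 ht
      (c := c) (by rw [hrη]; linarith)
    exact le_skorokhodDist_stepSet hrk hτ hinj hlarge hg

/-- there is `ε > 0` such that `A_EC^ε ∩ D_{≤r+1}` is bounded away from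
`D_{≤r}`; in particular this holds for every
`0 < ε ≤ (a − c₋)/(2(|c| + 4r² + 4r + 1))`. -/
theorem bounded_away_EC (c a : ℝ) (r : ℕ) (hr : 1 ≤ r) (ha : max 0 (-c) < a) :
    (∃ ε : ℝ, 0 < ε ∧ BoundedAwayEC c a ε r) ∧
    ∀ ε : ℝ, 0 < ε →
      ε ≤ (a - max 0 (-c)) / (2 * (|c| + 4 * (r:ℝ) ^ 2 + 4 * (r:ℝ) + 1)) →
      BoundedAwayEC c a ε r := by
  have hle : ∀ ε : ℝ, 0 < ε →
      ε ≤ (a - max 0 (-c)) / (2 * (|c| + 4 * (r:ℝ) ^ 2 + 4 * (r:ℝ) + 1)) →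
      BoundedAwayEC c a ε r := fun ε hε h => boundedAwayEC_of_le ha hε h
  have hpos : 0 < (a - max 0 (-c)) / (2 * (|c| + 4 * (r:ℝ) ^ 2 + 4 * (r:ℝ) + 1)) :=
    div_pos (sub_pos.2 ha) (by positivity)
  exact ⟨⟨_, hpos, hle _ hpos le_rfl⟩, hle⟩
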